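/- For every ε > 0 there exist a binomial multisum f : ℕ → ℕ and a real number A with 1 - ε < A < 1 + ε such that f(n)/C_n → A as n → ∞, where C_n denotes the n-th Catalan number. -/

import Mathlib

/-- Modified binomial coefficient: `C(a,b) = a!/((a-b)!·b!)` if `0 ≤ b ≤ a`,
`C(-1,0) = 1`, and `0` otherwise. -/
def mbinom (a b : ℤ) : ℕ :=
  if 0 ≤ b ∧ b ≤ a then a.toNat.choose b.toNat
  else if a = -1 ∧ b = 0 then 1 else 0

/-- The general term of a binomial multisum, indexed by `v ∈ ℤ^d`. -/
def multisumTerm {r d : ℕ} (A B : Fin r → Fin d → ℤ) (a' a'' b' b'' : Fin r → ℤ)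
    (n : ℕ) (v : Fin d → ℤ) : ℕ :=
  ∏ i, mbinom ((∑ j, A i j * v j) + a' i * (n : ℤ) + a'' i)
              ((∑ j, B i j * v j) + b' i * (n : ℤ) + b'' i)

/-- `f : ℕ → ℕ` is a binomial multisum: for every `n` only finitely many `v ∈ ℤ^d`
contribute, and `f n` is the (finite) sum of the products of modified binomial
coefficients of integer-coefficient affine functions of `(v, n)`. -/
def IsBinomialMultisum (f : ℕ → ℕ) : Prop :=
  ∃ (r d : ℕ) (A B : Fin r → Fin d → ℤ) (a' a'' b' b'' : Fin r → ℤ),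
    (∀ n : ℕ, (Function.support (multisumTerm A B a' a'' b' b'' n)).Finite) ∧
    ∀ n : ℕ, f n = ∑ᶠ v : Fin d → ℤ, multisumTerm A B a' a'' b' b'' n v

open Filter Topology

lemma mbinom_self (a : ℤ) : mbinom a a = if 0 ≤ a then 1 else 0 := by
  unfold mbinom
  split_ifs <;> first | omega | simp

lemma mbinom_zero_left (b : ℤ) : mbinom 0 b = if b = 0 then 1 else 0 := by
  unfold mbinom
  split_ifs with h₁ h₂ h₃ h₄ <;> first | omega | simp_all

lemma mbinom_natCast_one (m : ℕ) : mbinom m 1 = m := by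
  unfold mbinom
  split_ifs <;> first | omega | simp

lemma mbinom_two_mul_natCast (k : ℕ) : mbinom (2 * (k : ℤ)) k = k.centralBinom := by
  unfold mbinom
  rw [if_pos (by omega), Nat.centralBinom]
  congr 1

lemma mbinom_two_mul_of_neg {x : ℤ} (hx : x < 0) : mbinom (2 * x) x = 0 := by
  unfold mbinom
  rw [if_neg (by omega), if_neg (by omega)]

/-- The product of the central binomial coefficients of three nearly equal parts of `N`. -/
def balancedCentralBinom (N : ℕ) : ℕ :=
  (N / 3).centralBinom * ((N + 1) / 3).centralBinom * ((N + 2) / 3).centralBinom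

/-- The multisum runs over `x ≤ y ≤ z ≤ x + 1` with `x + y + z = n - k`. -/
lemma isBinomialMultisum_balancedCentralBinom (m k : ℕ) :
    IsBinomialMultisum fun n => if k ≤ n then m * balancedCentralBinom (n - k) else 0 := by
  let A : Fin 8 → Fin 3 → ℤ := ![![0, 0, 0], ![-1, 1, 0], ![0, -1, 1], ![1, 0, -1],
    ![2, 0, 0], ![0, 2, 0], ![0, 0, 2], ![0, 0, 0]]
  let B : Fin 8 → Fin 3 → ℤ := ![![-1, -1, -1], ![-1, 1, 0], ![0, -1, 1], ![1, 0, -1],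
    ![1, 0, 0], ![0, 1, 0], ![0, 0, 1], ![0, 0, 0]]
  let a'' : Fin 8 → ℤ := ![0, 0, 0, 1, 0, 0, 0, m]
  let b' : Fin 8 → ℤ := ![1, 0, 0, 0, 0, 0, 0, 0]
  let b'' : Fin 8 → ℤ := ![-k, 0, 0, 1, 0, 0, 0, 1]
  have term_eq (n : ℕ) (v : Fin 3 → ℤ) : multisumTerm A B 0 a'' b' b'' n v =
      mbinom 0 (n - k - v 0 - v 1 - v 2) * mbinom (v 1 - v 0) (v 1 - v 0) *
      mbinom (v 2 - v 1) (v 2 - v 1) * mbinom (v 0 + 1 - v 2) (v 0 + 1 - v 2) *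
      mbinom (2 * v 0) (v 0) * mbinom (2 * v 1) (v 1) * mbinom (2 * v 2) (v 2) * m := by
    rw [← mbinom_natCast_one m]
    simp only [multisumTerm, Fin.prod_univ_eight, Fin.sum_univ_three]
    simp [A, B, a'', b', b'']
    ring_nf
    simp
  let v₀ (n : ℕ) : Fin 3 → ℤ :=
    ![((n : ℤ) - k) / 3, ((n : ℤ) - k + 1) / 3, ((n : ℤ) - k + 2) / 3]
  have term_zero (n : ℕ) (v : Fin 3 → ℤ) (hv : v ≠ v₀ n) :
      multisumTerm A B 0 a'' b' b'' n v = 0 := by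
    contrapose! hv
    rw [term_eq, mbinom_zero_left, mbinom_self, mbinom_self, mbinom_self] at hv
    simp only [ne_eq, mul_eq_zero, not_or, ite_eq_right_iff, one_ne_zero, imp_false,
      not_not] at hv
    ext i
    fin_cases i <;> simp [v₀] <;> omega
  refine ⟨8, 3, A, B, 0, a'', b', b'', fun n => ?_, fun n => ?_⟩
  · refine (Set.finite_singleton (v₀ n)).subset fun v hv => ?_
    by_contra h
    exact hv (term_zero n v h)
  · rw [finsum_eq_single _ (v₀ n) (term_zero n), term_eq]
    beta_reduce
    split_ifs with h
    · obtain ⟨N, rfl⟩ := Nat.exists_eq_add_of_le h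
      have h₀ : v₀ (k + N) 0 = ((N / 3 : ℕ) : ℤ) := by simp [v₀]
      have h₁ : v₀ (k + N) 1 = (((N + 1) / 3 : ℕ) : ℤ) := by simp [v₀]
      have h₂ : v₀ (k + N) 2 = (((N + 2) / 3 : ℕ) : ℤ) := by simp [v₀]
      rw [h₀, h₁, h₂, mbinom_two_mul_natCast, mbinom_two_mul_natCast, mbinom_two_mul_natCast,
        mbinom_zero_left, mbinom_self, mbinom_self, mbinom_self, if_pos (by omega),
        if_pos (by omega), if_pos (by omega), if_pos (by omega), Nat.add_sub_cancel_left,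
        balancedCentralBinom]
      ring
    · rw [mbinom_two_mul_of_neg (x := v₀ n 0) (by simp [v₀]; omega)]
      simp

/-- The central binomial coefficient divided by its growth rate `4 ^ k / √k`. -/
noncomputable def normalizedCentralBinom (k : ℕ) : ℝ :=
  k.centralBinom * √k / 4 ^ k

lemma normalizedCentralBinom_eq_stirlingSeq {k : ℕ} (hk : k ≠ 0) :
    normalizedCentralBinom k = Stirling.stirlingSeq (2 * k) / Stirling.stirlingSeq k ^ 2 := by
  have hk' : (0 : ℝ) < k := by positivity
  have hfac : ((2 * k).factorial : ℝ) = k.centralBinom * (k.factorial : ℝ) ^ 2 := by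
    have := Nat.choose_mul_factorial_mul_factorial (n := 2 * k) (k := k) (by omega)
    rw [show 2 * k - k = k by omega] at this
    rw [← this, Nat.centralBinom]
    push_cast
    ring
  have h₁ : √(2 * ((2 * k : ℕ) : ℝ)) = 2 * √k := by
    rw [show 2 * ((2 * k : ℕ) : ℝ) = 2 ^ 2 * k by push_cast; ring,
      Real.sqrt_mul (by positivity), Real.sqrt_sq (by norm_num)]
  have h₂ : √(2 * (k : ℝ)) ^ 2 = 2 * (√k) ^ 2 := by
    rw [Real.sq_sqrt (by positivity), Real.sq_sqrt (by positivity)]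
  have h₃ : (((2 * k : ℕ) : ℝ) / Real.exp 1) ^ (2 * k) =
      4 ^ k * (((k : ℝ) / Real.exp 1) ^ k) ^ 2 := by
    rw [← pow_mul, mul_comm k 2, show (4 : ℝ) ^ k = 2 ^ (2 * k) by rw [pow_mul]; norm_num,
      ← mul_pow]
    push_cast
    ring
  rw [normalizedCentralBinom, Stirling.stirlingSeq, Stirling.stirlingSeq, hfac, h₁, h₃,
    div_pow (k.factorial : ℝ), mul_pow (√(2 * (k : ℝ))), h₂]
  have : (0 : ℝ) < k.factorial := by positivity
  field_simp

lemma tendsto_normalizedCentralBinom :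
    Tendsto normalizedCentralBinom atTop (𝓝 (√Real.pi / √Real.pi ^ 2)) := by
  have h := Stirling.tendsto_stirlingSeq_sqrt_pi
  have h₂ := h.comp (tendsto_id.const_mul_atTop' (show 0 < 2 by norm_num))
  refine (h₂.div (h.pow 2) (by positivity)).congr' ?_
  filter_upwards [eventually_ne_atTop 0] with k hk
  exact (normalizedCentralBinom_eq_stirlingSeq hk).symm

lemma tendsto_sub_add_div_three (k j : ℕ) :
    Tendsto (fun n : ℕ => (n - k + j) / 3) atTop atTop :=
  (Nat.tendsto_div_const_atTop (by norm_num)).comp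
    (tendsto_atTop_mono (fun _ => Nat.le_add_right _ j) (tendsto_sub_atTop_nat k))

lemma tendsto_div_sub_add_div_three (k j : ℕ) :
    Tendsto (fun n : ℕ => (n : ℝ) / ((n - k + j) / 3 : ℕ)) atTop (𝓝 3) := by
  have hq := tendsto_sub_add_div_three k j
  have hb : Tendsto (fun n : ℕ => (k + j + 3 : ℝ) / ((n - k + j) / 3 : ℕ)) atTop (𝓝 0) :=
    (tendsto_natCast_atTop_atTop.comp hq).const_div_atTop _
  rw [tendsto_iff_norm_sub_tendsto_zero]
  refine squeeze_zero' (.of_forall fun n => norm_nonneg _) ?_ hb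
  filter_upwards [eventually_ge_atTop k, hq.eventually_gt_atTop 0] with n hn hpos
  have hpos' : (0 : ℝ) < ((n - k + j) / 3 : ℕ) := by exact_mod_cast hpos
  have h₁ : (n : ℝ) ≤ 3 * ((n - k + j) / 3 : ℕ) + (k + j + 3) := by
    exact_mod_cast (by omega : n ≤ 3 * ((n - k + j) / 3) + (k + j + 3))
  have h₂ : 3 * (((n - k + j) / 3 : ℕ) : ℝ) ≤ n + (k + j + 3) := by
    exact_mod_cast (by omega : 3 * ((n - k + j) / 3) ≤ n + (k + j + 3))
  rw [Real.norm_eq_abs, div_sub' hpos'.ne', abs_div, abs_of_pos hpos']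
  gcongr
  rw [abs_le]
  constructor <;> linarith

lemma centralBinom_eq_normalized {k : ℕ} (hk : 0 < k) :
    (k.centralBinom : ℝ) = normalizedCentralBinom k * 4 ^ k / √k := by
  have : (0 : ℝ) < k := by exact_mod_cast hk
  rw [normalizedCentralBinom]
  field_simp

lemma catalan_eq_centralBinom_div_real (n : ℕ) :
    (catalan n : ℝ) = n.centralBinom / (n + 1) := by
  have := succ_mul_catalan_eq_centralBinom n
  rw [← this]
  push_cast
  field_simp

lemma exists_tendsto_balancedCentralBinom_div_catalan :
    ∃ c : ℝ, 0 < c ∧ ∀ k : ℕ, Tendsto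
      (fun n : ℕ => (balancedCentralBinom (n - k) : ℝ) / catalan n) atTop (𝓝 (c / 4 ^ k)) := by
  set L : ℝ := √Real.pi / √Real.pi ^ 2
  have hL : 0 < L := by positivity
  refine ⟨L * √3 * (L * √3) * (L * √3) / L, by positivity, fun k => ?_⟩
  have part (j : ℕ) : Tendsto (fun n : ℕ => normalizedCentralBinom ((n - k + j) / 3) *
      √((n : ℝ) / ((n - k + j) / 3 : ℕ))) atTop (𝓝 (L * √3)) :=
    (tendsto_normalizedCentralBinom.comp (tendsto_sub_add_div_three k j)).mul
      (tendsto_div_sub_add_div_three k j).sqrt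
  have hone : Tendsto (fun n : ℕ => 1 + 1 / (n : ℝ)) atTop (𝓝 1) := by
    simpa using tendsto_one_div_atTop_nhds_zero_nat.const_add (1 : ℝ)
  have hlim := (((((part 0).mul (part 1)).mul (part 2)).div tendsto_normalizedCentralBinom
    hL.ne').mul hone).div_const (4 ^ k)
  rw [mul_one] at hlim
  refine hlim.congr' ?_
  filter_upwards [eventually_ge_atTop (k + 3)] with n hn
  have hn0 : (0 : ℝ) < n := by exact_mod_cast (by omega : 0 < n)
  have hq₀ : 0 < (n - k + 0) / 3 := by omega
  have hq₁ : 0 < (n - k + 1) / 3 := by omega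
  have hq₂ : 0 < (n - k + 2) / 3 := by omega
  have hsum : n = (n - k + 0) / 3 + (n - k + 1) / 3 + (n - k + 2) / 3 + k := by omega
  have hpow : (4 : ℝ) ^ n =
      4 ^ ((n - k + 0) / 3) * 4 ^ ((n - k + 1) / 3) * 4 ^ ((n - k + 2) / 3) * 4 ^ k := by
    rw [← pow_add, ← pow_add, ← pow_add, ← hsum]
  have hu : 0 < normalizedCentralBinom n := by
    have := Nat.centralBinom_pos n
    unfold normalizedCentralBinom
    positivity
  rw [catalan_eq_centralBinom_div_real, balancedCentralBinom,
    show (n - k) / 3 = (n - k + 0) / 3 from rfl, Nat.cast_mul, Nat.cast_mul,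
    centralBinom_eq_normalized hq₀, centralBinom_eq_normalized hq₁,
    centralBinom_eq_normalized hq₂, centralBinom_eq_normalized (show 0 < n by omega), hpow]
  simp only [Pi.div_apply, Real.sqrt_div hn0.le]
  generalize (n - k + 0) / 3 = p at *
  generalize (n - k + 1) / 3 = q at *
  generalize (n - k + 2) / 3 = r at *
  have hp : (0 : ℝ) < p := by exact_mod_cast hq₀
  have hq : (0 : ℝ) < q := by exact_mod_cast hq₁
  have hr : (0 : ℝ) < r := by exact_mod_cast hq₂
  have hs := Real.sq_sqrt hn0.le
  have hsp : 0 < √(n : ℝ) := by positivity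
  generalize √(n : ℝ) = s at *
  rw [← hs]
  field_simp

lemma exists_nat_mul_div_four_pow_near_one {c ε : ℝ} (hc : 0 < c) (hε : 0 < ε) :
    ∃ m k : ℕ, 1 - ε < m * (c / 4 ^ k) ∧ m * (c / 4 ^ k) < 1 + ε := by
  obtain ⟨k, hk⟩ := pow_unbounded_of_one_lt (c / ε) (by norm_num : (1 : ℝ) < 4)
  have hδ : 0 < c / 4 ^ k := by positivity
  have hδε : c / 4 ^ k < ε := by
    rw [div_lt_iff₀ hε] at hk
    rw [div_lt_iff₀ (by positivity)]
    linarith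
  refine ⟨⌊1 / (c / 4 ^ k)⌋₊, k, ?_, ?_⟩
  · have := Nat.lt_floor_add_one (1 / (c / 4 ^ k))
    rw [div_lt_iff₀ hδ] at this
    linarith
  · have := Nat.floor_le (a := 1 / (c / 4 ^ k)) (by positivity)
    rw [le_div_iff₀ hδ] at this
    linarith

/-- For every `ε > 0` there is a binomial multisum (= tile counting function) `f` with
`f(n)/C_n → A` for some `A ∈ (1-ε, 1+ε)`, where `C_n` is the `n`-th Catalan number. -/
theorem exists_tileCounting_near_catalan (ε : ℝ) (hε : 0 < ε) :
    ∃ (f : ℕ → ℕ) (A : ℝ), IsBinomialMultisum f ∧ 1 - ε < A ∧ A < 1 + ε ∧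
      Filter.Tendsto (fun n : ℕ => (f n : ℝ) / (catalan n : ℝ)) Filter.atTop (nhds A) := by
  obtain ⟨c, hc, hlim⟩ := exists_tendsto_balancedCentralBinom_div_catalan
  obtain ⟨m, k, hlow, hhigh⟩ := exists_nat_mul_div_four_pow_near_one hc hε
  refine ⟨_, _, isBinomialMultisum_balancedCentralBinom m k, hlow, hhigh,
    ((hlim k).const_mul (m : ℝ)).congr' ?_⟩
  filter_upwards [eventually_ge_atTop k] with n hn
  rw [if_pos hn, Nat.cast_mul, mul_div_assoc]
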